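/- Let d ∈ ℕ and let 𝒫 be a finite family of polytopes in ℝ^d, each of dimension at least one, with 2 ≤ |𝒫| < ∞. Let ρ > 0 and Δ > 0 be such that every P ∈ 𝒫 is contained in the ball ρ·B^d, and for every two distinct P, P' ∈ 𝒫 one has dist(P, P') ≥ Δ. Then max_{P ∈ 𝒫} xc(P) ≥ (log₂|𝒫| / (8·d·(1 + log₂(2ρ/Δ) + log₂ log₂ |𝒫|)))^{1/2}. -/

import Mathlib

open Metric Set

noncomputable section

/-- A polytope: convex hull of a finite set. -/
def IsPolytope {d : ℕ} (P : Set (EuclideanSpace ℝ (Fin d))) : Prop :=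
  ∃ V : Finset (EuclideanSpace ℝ (Fin d)), P = convexHull ℝ (V : Set (EuclideanSpace ℝ (Fin d)))

/-- `P` has an extended formulation with `l` LMIs of size `m`. -/
def HasSdpExtBlocks {d : ℕ} (P : Set (EuclideanSpace ℝ (Fin d))) (l m : ℕ) : Prop :=
  ∃ (n : ℕ) (φ : EuclideanSpace ℝ (Fin n) →ᵃ[ℝ] EuclideanSpace ℝ (Fin d))
    (M : Fin l → (EuclideanSpace ℝ (Fin n) →ᵃ[ℝ] Matrix (Fin m) (Fin m) ℝ)),
    (∀ i x, (M i x).IsSymm) ∧ P = φ '' {x | ∀ i, (M i x).PosSemidef}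

/-- `P` has an extended formulation with a single LMI of size `k`. -/
def HasSdpExt {d : ℕ} (P : Set (EuclideanSpace ℝ (Fin d))) (k : ℕ) : Prop :=
  ∃ (n : ℕ) (φ : EuclideanSpace ℝ (Fin n) →ᵃ[ℝ] EuclideanSpace ℝ (Fin d))
    (M : EuclideanSpace ℝ (Fin n) →ᵃ[ℝ] Matrix (Fin k) (Fin k) ℝ),
    (∀ x, (M x).IsSymm) ∧ P = φ '' {x | (M x).PosSemidef}

/-- `P` has an extended formulation with `l` linear inequalities. -/
def HasLinExt {d : ℕ} (P : Set (EuclideanSpace ℝ (Fin d))) (l : ℕ) : Prop :=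
  ∃ (n : ℕ) (φ : EuclideanSpace ℝ (Fin n) →ᵃ[ℝ] EuclideanSpace ℝ (Fin d))
    (a : Fin l → (EuclideanSpace ℝ (Fin n) →ᵃ[ℝ] ℝ)),
    P = φ '' {x | ∀ i, 0 ≤ a i x}

open Classical in
/-- Semidefinite extension complexity. -/
def sxc {d : ℕ} (P : Set (EuclideanSpace ℝ (Fin d))) : ℕ :=
  if P = ∅ ∨ ∃ p, P = {p} then 0 else sInf {k | HasSdpExt P k}

open Classical in
/-- Linear extension complexity. -/
def xc {d : ℕ} (P : Set (EuclideanSpace ℝ (Fin d))) : ℕ :=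
  if P = ∅ ∨ ∃ p, P = {p} then 0 else sInf {l | HasLinExt P l}

/-- Spectral norm of a square real matrix (the operator norm of the induced map
on Euclidean space; for a symmetric matrix this is the largest absolute value of
an eigenvalue). -/
def specNorm {ι : Type*} [Fintype ι] [DecidableEq ι] (T : Matrix ι ι ℝ) : ℝ :=
  ‖LinearMap.toContinuousLinearMap (Matrix.toEuclideanLin T)‖

/-- Norm of a linear map into square matrices: the maximum of the spectral norm
of the values over the unit ball. -/
def lmNorm {n : ℕ} {ι : Type*} [Fintype ι] [DecidableEq ι]
    (A : EuclideanSpace ℝ (Fin n) →ₗ[ℝ] Matrix ι ι ℝ) : ℝ :=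
  sSup {r | ∃ x : EuclideanSpace ℝ (Fin n), ‖x‖ ≤ 1 ∧ r = specNorm (A x)}

/-- A 0/1-polytope: the convex hull of a set of 0/1-vectors. -/
def IsZeroOnePolytope {d : ℕ} (P : Set (EuclideanSpace ℝ (Fin d))) : Prop :=
  ∃ V : Set (EuclideanSpace ℝ (Fin d)),
    V ⊆ {x | ∀ i, x i = 0 ∨ x i = 1} ∧ P = convexHull ℝ V

/-- Bounded-coefficient spanning subfamily of a finite family of vectors. -/
lemma exists_bounded_spanning {V : Type*} [Finite V] [Nonempty V] {K : ℕ}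
    (u : V → (Fin K → ℝ)) :
    ∃ f : Fin K → V, ∀ w, ∃ c : Fin K → ℝ, (∀ j, |c j| ≤ 1) ∧ u w = ∑ j, c j • u (f j) := by
  classical
  let S := Submodule.span ℝ (Set.range u)
  let m := Module.finrank ℝ S
  have hm : m ≤ K := by
    have := Submodule.finrank_le S
    simpa using this
  let b : Module.Basis (Fin m) ℝ S := Module.finBasis ℝ S
  let u' : V → S := fun w => ⟨u w, Submodule.subset_span ⟨w, rfl⟩⟩
  have hspan' : ⊤ ≤ Submodule.span ℝ (Set.range u') := by
    rintro ⟨x, hx⟩ -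
    have key : ∀ y (hy : y ∈ Submodule.span ℝ (Set.range u)),
        (⟨y, hy⟩ : S) ∈ Submodule.span ℝ (Set.range u') := by
      intro y hy
      induction hy using Submodule.span_induction with
      | mem x h => obtain ⟨w, rfl⟩ := h; exact Submodule.subset_span ⟨w, rfl⟩
      | zero => exact Submodule.zero_mem _
      | add x y hx hy h1 h2 => exact Submodule.add_mem _ h1 h2
      | smul a x hx h1 => exact Submodule.smul_mem _ a h1
    exact key x hx
  obtain ⟨f₀, hf₀⟩ : ∃ f : Fin m → V, b.det (u' ∘ f) ≠ 0 := by
    obtain ⟨κ, g, hg, hsp, hli⟩ := exists_linearIndependent' ℝ u'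
    let e : Module.Basis κ ℝ S := Module.Basis.mk hli (by rw [hsp]; exact hspan')
    have : Finite κ := Finite.of_injective g hg
    have := Fintype.ofFinite κ
    have hc : Fintype.card κ = m := (Module.finrank_eq_card_basis e).symm
    let σ : Fin m ≃ κ := (Fintype.equivFinOfCardEq hc).symm
    refine ⟨g ∘ σ, ?_⟩
    have h1 := (b.is_basis_iff_det (v := e.reindex σ.symm)).1
      ⟨(e.reindex σ.symm).linearIndependent, (e.reindex σ.symm).span_eq⟩
    have h2 : (⇑(e.reindex σ.symm) : Fin m → S) = u' ∘ (g ∘ σ) := by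
      ext j : 1
      simp [e]
    rw [h2] at h1
    exact h1.ne_zero
  obtain ⟨f, hf⟩ := Finite.exists_max (fun f : Fin m → V => |b.det (u' ∘ f)|)
  have hfpos : 0 < |b.det (u' ∘ f)| := lt_of_lt_of_le (abs_pos.2 hf₀) (hf f₀)
  have hfne : b.det (u' ∘ f) ≠ 0 := abs_pos.1 hfpos
  obtain ⟨hli, hsp⟩ := (b.is_basis_iff_det (v := u' ∘ f)).2 (isUnit_iff_ne_zero.2 hfne)
  let e : Module.Basis (Fin m) ℝ S := Module.Basis.mk hli hsp.ge
  have he : ∀ j, e j = u' (f j) := fun j => by simp [e]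
  have hcoef : ∀ w j, |e.repr (u' w) j| ≤ 1 := by
    intro w j
    have h1 : b.det (Function.update (u' ∘ f) j (u' w)) = e.repr (u' w) j * b.det (u' ∘ f) := by
      conv_lhs => rw [← e.sum_repr (u' w)]
      rw [AlternatingMap.map_update_sum, Finset.sum_eq_single j]
      · rw [AlternatingMap.map_update_smul, he]
        have : Function.update (u' ∘ f) j (u' (f j)) = u' ∘ f := Function.update_eq_self j (u' ∘ f)
        rw [this, smul_eq_mul]
      · intro i _ hij
        rw [AlternatingMap.map_update_smul, he]
        have := AlternatingMap.map_update_self b.det (u' ∘ f) (i := j) (j := i) (Ne.symm hij)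
        simp only [Function.comp_apply] at this
        rw [this, smul_zero]
      · simp
    have h2 : Function.update (u' ∘ f) j (u' w) = u' ∘ (Function.update f j w) := by
      ext i : 1
      by_cases h : i = j
      · subst h; simp
      · simp [h]
    have h3 := hf (Function.update f j w)
    rw [← h2, h1, abs_mul] at h3
    exact le_of_mul_le_mul_right (by linarith) hfpos
  have w₀ : V := Classical.arbitrary V
  refine ⟨fun j => if h : j.1 < m then f ⟨j, h⟩ else w₀, fun w =>
    ⟨fun j => if h : j.1 < m then e.repr (u' w) ⟨j, h⟩ else 0, ?_, ?_⟩⟩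
  · intro j
    by_cases h : j.1 < m
    · simp only [h, dif_pos]; exact hcoef _ _
    · simp [h]
  · have h1 : u w = ∑ j : Fin m, e.repr (u' w) j • u (f j) := by
      have := congrArg (Subtype.val) (e.sum_repr (u' w))
      have h2 : u w = ((u' w : S) : Fin K → ℝ) := rfl
      rw [h2, ← this]
      simp only [he, Submodule.coe_sum, Submodule.coe_smul, u']
    rw [h1]
    have h3 : ∀ (m : ℕ) (hm : m ≤ K) (g : Fin m → ℝ) (f : Fin m → V),
        ∑ j, g j • u (f j) = ∑ j : Fin K, (if h : j.1 < m then g ⟨j, h⟩ else 0) •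
          u (if h : j.1 < m then f ⟨j, h⟩ else w₀) := by
      intro m hm g f
      symm
      rw [← Finset.sum_subset (Finset.subset_univ (Finset.univ.map (Fin.castLEEmb hm)))]
      · rw [Finset.sum_map]
        simp
      · intro j _ hj
        have : ¬ j.1 < m := fun h => hj (by
          simp only [Finset.mem_map, Finset.mem_univ, true_and]
          exact ⟨⟨j, h⟩, rfl⟩)
        simp [this]
    exact h3 m hm _ f

lemma affine_comb {E G : Type*} [AddCommGroup E] [Module ℝ E] [AddCommGroup G] [Module ℝ G]
    {K : ℕ} (g : E →ᵃ[ℝ] G) (c : Fin K → ℝ) (hc : ∑ j, c j = 1) (v : Fin K → E) :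
    g (∑ j, c j • v j) = ∑ j, c j • g (v j) := by
  have h : ∀ x, g x = g.linear x + g 0 := fun x => by
    have := g.decomp
    exact congrFun this x
  rw [h]
  simp_rw [h (v _)]
  simp [smul_add, Finset.sum_add_distrib, ← Finset.sum_smul, hc]

lemma bounded_const {d : ℕ} {E : Type*} [AddCommGroup E] [Module ℝ E]
    (φ : E →ᵃ[ℝ] EuclideanSpace ℝ (Fin d)) {ρ : ℝ} (x y : E)
    (h : ∀ t : ℝ, ‖φ (AffineMap.lineMap x y t)‖ ≤ ρ) : φ x = φ y := by
  by_contra hne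
  have hpos : 0 < ‖φ y - φ x‖ := norm_pos_iff.2 (sub_ne_zero.2 (Ne.symm hne))
  have hρ : 0 ≤ ρ := (norm_nonneg _).trans (h 0)
  have h1 := h ((2 * ρ + 1) / ‖φ y - φ x‖)
  have h0 := h 0
  rw [AffineMap.apply_lineMap] at h1 h0
  rw [AffineMap.lineMap_apply_zero] at h0
  rw [AffineMap.lineMap_apply_module'] at h1
  have h2 : ‖((2 * ρ + 1) / ‖φ y - φ x‖) • (φ y - φ x)‖ = 2 * ρ + 1 := by
    rw [norm_smul, Real.norm_eq_abs, abs_of_nonneg (by positivity)]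
    field_simp
  have h3 := norm_le_norm_add_norm_sub' (((2 * ρ + 1) / ‖φ y - φ x‖) • (φ y - φ x))
    (((2 * ρ + 1) / ‖φ y - φ x‖) • (φ y - φ x) + φ x)
  have h4 : ((2 * ρ + 1) / ‖φ y - φ x‖) • (φ y - φ x) -
    (((2 * ρ + 1) / ‖φ y - φ x‖) • (φ y - φ x) + φ x) = - φ x := by abel
  rw [h4, norm_neg] at h3
  linarith

/-- Normalised encoding of a polytope with `k` inequalities. -/
structure Enc {d : ℕ} (P : Set (EuclideanSpace ℝ (Fin d))) (k : ℕ) where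
  p : Fin (k + 1) → EuclideanSpace ℝ (Fin d)
  s : Fin k → Fin (k + 1) → ℝ
  hp : ∀ j, p j ∈ P
  hs : ∀ i j, 0 ≤ s i j
  hsum : ∀ i, ∑ j, s i j = 1
  mem : ∀ c : Fin (k + 1) → ℝ, ∑ j, c j = 1 → (∀ i, 0 ≤ ∑ j, c j * s i j) → ∑ j, c j • p j ∈ P
  rep : ∀ x ∈ P, ∃ c : Fin (k + 1) → ℝ, ∑ j, c j = 1 ∧ (∀ j, |c j| ≤ 1) ∧
    (∀ i, 0 ≤ ∑ j, c j * s i j) ∧ x = ∑ j, c j • p j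

lemma exists_enc {d : ℕ} {P : Set (EuclideanSpace ℝ (Fin d))} {k : ℕ} {ρ : ℝ}
    (hpoly : IsPolytope P) (hne : P.Nonempty) (hball : P ⊆ Metric.closedBall 0 ρ)
    (hext : HasLinExt P k) : Nonempty (Enc P k) := by
  classical
  obtain ⟨V, hV⟩ := hpoly
  obtain ⟨n, φ, a, ha⟩ := hext
  have hVP : ∀ w : V, w.1 ∈ P := fun w => by
    rw [hV]; exact subset_convexHull _ _ w.2
  have hVne : Nonempty V := by
    rw [hV, convexHull_nonempty_iff] at hne
    exact hne.to_subtype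
  have hex : ∀ w : V, ∃ x, (∀ i, 0 ≤ a i x) ∧ φ x = w.1 := fun w => by
    have := hVP w
    rw [ha] at this
    exact this
  choose x hx hφx using hex
  have hmemP : ∀ y, (∀ i, 0 ≤ a i y) → φ y ∈ P := fun y hy => by rw [ha]; exact ⟨y, hy, rfl⟩
  obtain ⟨f, hf⟩ := exists_bounded_spanning (K := k + 1)
    (fun w : V => (Fin.cons 1 (fun i => a i (x w)) : Fin (k + 1) → ℝ))
  let v := fun j => x (f j)
  let σ := fun i => ∑ j, a i (v j)
  have hav : ∀ i j, 0 ≤ a i (v j) := fun i j => hx _ i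
  have hσ : ∀ i, 0 ≤ σ i := fun i => Finset.sum_nonneg fun j _ => hav i j
  have hσ0 : ∀ i, σ i = 0 → ∀ j, a i (v j) = 0 := fun i h j =>
    (Finset.sum_eq_zero_iff_of_nonneg (fun j _ => hav i j)).1 h j (Finset.mem_univ _)
  let s : Fin k → Fin (k + 1) → ℝ := fun i j =>
    if σ i = 0 then 1 / ((k : ℝ) + 1) else a i (v j) / σ i
  have hs0 : ∀ (c : Fin (k + 1) → ℝ) i, ∑ j, c j = 1 → σ i = 0 →
      ∑ j, c j * s i j = 1 / ((k : ℝ) + 1) := by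
    intro c i hc h
    simp only [s, h, if_true]
    rw [← Finset.sum_mul, hc, one_mul]
  have hs1 : ∀ (c : Fin (k + 1) → ℝ) i, σ i ≠ 0 →
      ∑ j, c j * s i j = (∑ j, c j * a i (v j)) / σ i := by
    intro c i h
    simp only [s, h, if_false]
    rw [Finset.sum_div]
    exact Finset.sum_congr rfl fun j _ => by ring
  refine ⟨⟨fun j => φ (v j), s, fun j => hmemP _ (hav · j), ?_, ?_, ?_, ?_⟩⟩
  · intro i j
    by_cases h : σ i = 0
    · simp only [s, h, if_true]; positivity
    · simp only [s, h, if_false]; exact div_nonneg (hav i j) (hσ i)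
  · intro i
    by_cases h : σ i = 0
    · simp only [s, h, if_true]; simp; field_simp
    · simp only [s, h, if_false]; rw [← Finset.sum_div]; exact div_self h
  · intro c hc hpos
    rw [← affine_comb φ c hc v]
    apply hmemP
    intro i
    rw [affine_comb (a i) c hc v]
    simp only [smul_eq_mul]
    by_cases h : σ i = 0
    · simp [hσ0 i h]
    · have := hpos i
      rw [hs1 c i h] at this
      have hp : 0 < σ i := lt_of_le_of_ne (hσ i) (Ne.symm h)
      by_contra hneg
      push Not at hneg
      have := div_neg_of_neg_of_pos hneg hp
      linarith
  · let T : Set (EuclideanSpace ℝ (Fin d)) := {y | ∃ c : Fin (k + 1) → ℝ, ∑ j, c j = 1 ∧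
      (∀ j, |c j| ≤ 1) ∧ (∀ i, 0 ≤ ∑ j, c j * s i j) ∧ y = ∑ j, c j • φ (v j)}
    have hT : Convex ℝ T := by
      rintro y ⟨c, h1, h2, h3, rfl⟩ y' ⟨c', h1', h2', h3', rfl⟩ α β hα hβ hαβ
      refine ⟨fun j => α * c j + β * c' j, ?_, ?_, ?_, ?_⟩
      · rw [Finset.sum_add_distrib, ← Finset.mul_sum, ← Finset.mul_sum, h1, h1']; linarith
      · intro j
        have e1 := abs_le.1 (h2 j)
        have e2 := abs_le.1 (h2' j)
        rw [abs_le]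
        constructor <;> nlinarith
      · intro i
        have : ∑ j, (α * c j + β * c' j) * s i j =
            α * ∑ j, c j * s i j + β * ∑ j, c' j * s i j := by
          rw [Finset.mul_sum, Finset.mul_sum, ← Finset.sum_add_distrib]
          exact Finset.sum_congr rfl fun j _ => by ring
        rw [this]
        have := h3 i
        have := h3' i
        positivity
      · rw [Finset.smul_sum, Finset.smul_sum, ← Finset.sum_add_distrib]
        exact Finset.sum_congr rfl fun j _ => by rw [add_smul, mul_smul, mul_smul]
    have hVT : (V : Set (EuclideanSpace ℝ (Fin d))) ⊆ T := by
      intro w hw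
      obtain ⟨c, hc1, hc2⟩ := hf ⟨w, hw⟩
      have hc : ∑ j, c j = 1 := by
        have := congrFun hc2 0
        simp at this
        exact this.symm
      have hai : ∀ i, a i (x ⟨w, hw⟩) = ∑ j, c j * a i (v j) := by
        intro i
        have := congrFun hc2 i.succ
        simpa [v] using this
      refine ⟨c, hc, hc1, ?_, ?_⟩
      · intro i
        by_cases h : σ i = 0
        · rw [hs0 c i hc h]; positivity
        · rw [hs1 c i h, ← hai]
          exact div_nonneg (hx _ i) (hσ i)
      · rw [← affine_comb φ c hc v]
        refine (hφx ⟨w, hw⟩).symm.trans ?_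
        apply bounded_const φ (ρ := ρ)
        intro t
        rw [← mem_closedBall_zero_iff]
        apply hball
        apply hmemP
        intro i
        rw [AffineMap.apply_lineMap, affine_comb (a i) c hc v]
        simp only [smul_eq_mul]
        rw [← hai, AffineMap.lineMap_same]
        exact hx _ i
    intro y hy
    rw [hV] at hy
    exact convexHull_min hVT hT hy

lemma enc_close {d k : ℕ} {P P' : Set (EuclideanSpace ℝ (Fin d))} (e : Enc P k) (e' : Enc P' k)
    {ρ ε w : ℝ} (hball : P ⊆ Metric.closedBall 0 ρ)
    (hε : 0 ≤ ε)
    (h1 : ∀ i j, |e.s i j - e'.s i j| ≤ ε) (h2 : ∀ j, ‖e.p j - e'.p j‖ ≤ w) :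
    ∀ x ∈ P, ∃ y ∈ P', dist x y ≤ 2 * ρ * (ε * ((k : ℝ) + 1) ^ 2) + ((k : ℝ) + 1) * w := by
  intro x hx
  obtain ⟨c, hc, hc1, hcs, rfl⟩ := e.rep x hx
  have hxn : ‖∑ j, c j • e.p j‖ ≤ ρ := mem_closedBall_zero_iff.1 (hball hx)
  set K : ℝ := (k : ℝ) + 1 with hK
  have hK1 : 1 ≤ K := by simp [hK]
  set t := ε * K ^ 2 with ht
  have ht0 : 0 ≤ t := by positivity
  have hpn : ∀ j, ‖e.p j‖ ≤ ρ := fun j => mem_closedBall_zero_iff.1 (hball (e.hp j))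
  have hρ : 0 ≤ ρ := (norm_nonneg _).trans (hpn 0)
  let c' : Fin (k + 1) → ℝ := fun j => (c j + t / K) / (1 + t)
  have hc'1 : ∑ j, c' j = 1 := by
    simp only [c']
    rw [← Finset.sum_div, Finset.sum_add_distrib, hc]
    simp
    rw [← hK]
    field_simp
  have hc'abs : ∀ j, |c' j| ≤ 1 := by
    intro j
    have e1 := abs_le.1 (hc1 j)
    have e2 : t / K ≤ t := div_le_self ht0 hK1
    have e3 : 0 ≤ t / K := by positivity
    simp only [c']
    rw [abs_div, abs_of_pos (by positivity : 0 < 1 + t), div_le_one (by positivity), abs_le]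
    constructor <;> linarith
  refine ⟨∑ j, c' j • e'.p j, e'.mem c' hc'1 ?_, ?_⟩
  · intro i
    have e1 : ∑ j, c' j * e'.s i j = (∑ j, c j * e'.s i j + t / K) / (1 + t) := by
      have : t / K = ∑ j, t / K * e'.s i j := by rw [← Finset.mul_sum, e'.hsum, mul_one]
      rw [this, ← Finset.sum_add_distrib, Finset.sum_div]
      exact Finset.sum_congr rfl fun j _ => by simp only [c']; ring
    rw [e1]
    apply div_nonneg _ (by positivity)
    have e2 : ∑ j, c j * (e.s i j - e'.s i j) ≤ K * ε := by
      calc ∑ j, c j * (e.s i j - e'.s i j) ≤ ∑ j : Fin (k + 1), ε := by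
            apply Finset.sum_le_sum
            intro j _
            calc c j * (e.s i j - e'.s i j) ≤ |c j * (e.s i j - e'.s i j)| := le_abs_self _
              _ = |c j| * |e.s i j - e'.s i j| := abs_mul _ _
              _ ≤ 1 * ε := mul_le_mul (hc1 j) (h1 i j) (abs_nonneg _) zero_le_one
              _ = ε := one_mul _
        _ = K * ε := by simp [hK]
    have e3 : ∑ j, c j * (e.s i j - e'.s i j) = ∑ j, c j * e.s i j - ∑ j, c j * e'.s i j := by
      rw [← Finset.sum_sub_distrib]
      exact Finset.sum_congr rfl fun j _ => by ring
    have e4 : t / K = K * ε := by rw [ht]; field_simp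
    have := hcs i
    linarith
  · rw [dist_eq_norm]
    set z := ∑ j, (1 / K) • e.p j with hz
    have hzn : ‖z‖ ≤ ρ := by
      calc ‖z‖ ≤ ∑ j, ‖(1 / K) • e.p j‖ := norm_sum_le _ _
        _ ≤ ∑ j : Fin (k + 1), (1 / K) * ρ := by
            apply Finset.sum_le_sum
            intro j _
            rw [norm_smul, Real.norm_eq_abs, abs_of_nonneg (by positivity)]
            exact mul_le_mul_of_nonneg_left (hpn j) (by positivity)
        _ = ρ := by simp; rw [← hK]; field_simp
    have e1 : ∑ j, c j • e.p j - ∑ j, c' j • e'.p j =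
        (t / (1 + t)) • (∑ j, c j • e.p j - z) + ∑ j, c' j • (e.p j - e'.p j) := by
      rw [hz, ← Finset.sum_sub_distrib, ← Finset.sum_sub_distrib, Finset.smul_sum,
        ← Finset.sum_add_distrib]
      refine Finset.sum_congr rfl fun j _ => ?_
      have : c j = t / (1 + t) * (c j - 1 / K) + c' j := by
        simp only [c']; field_simp; ring
      rw [smul_sub (c' j), ← sub_smul, smul_smul, add_sub, ← add_smul, ← this]
    rw [e1]
    refine (norm_add_le _ _).trans (add_le_add ?_ ?_)
    · rw [norm_smul, Real.norm_eq_abs, abs_of_nonneg (by positivity)]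
      have e2 : t / (1 + t) ≤ t := div_le_self ht0 (by linarith)
      have e3 : ‖∑ j, c j • e.p j - z‖ ≤ 2 * ρ := (norm_sub_le _ _).trans (by linarith)
      calc _ ≤ t * (2 * ρ) := mul_le_mul e2 e3 (norm_nonneg _) ht0
        _ = _ := by ring
    · calc ‖∑ j, c' j • (e.p j - e'.p j)‖ ≤ ∑ j, ‖c' j • (e.p j - e'.p j)‖ := norm_sum_le _ _
        _ ≤ ∑ j : Fin (k + 1), w := by
            apply Finset.sum_le_sum
            intro j _
            rw [norm_smul, Real.norm_eq_abs]
            calc _ ≤ 1 * w := mul_le_mul (hc'abs j) (h2 j) (norm_nonneg _) zero_le_one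
              _ = w := one_mul w
        _ = K * w := by simp [hK]

lemma HasLinExt.mono {d : ℕ} {P : Set (EuclideanSpace ℝ (Fin d))} {l k : ℕ} (hlk : l ≤ k)
    (h : HasLinExt P l) : HasLinExt P k := by
  obtain ⟨n, φ, a, rfl⟩ := h
  refine ⟨n, φ, fun i => if h : i.1 < l then a ⟨i, h⟩ else 0, ?_⟩
  congr 1
  ext x
  simp only [Set.mem_ofPred_eq]
  constructor
  · intro h i
    by_cases hi : i.1 < l
    · simp only [hi, dif_pos]; exact h _
    · simp [hi]
  · intro h i
    have := h ⟨i, i.2.trans_le hlk⟩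
    simpa using this

lemma IsPolytope.exists_ext {d : ℕ} {P : Set (EuclideanSpace ℝ (Fin d))} (h : IsPolytope P) :
    ∃ l, HasLinExt P l := by
  classical
  obtain ⟨V, rfl⟩ := h
  let r := V.card
  let q : Fin r → EuclideanSpace ℝ (Fin d) := fun j => (V.equivFin.symm j).1
  have hq : Set.range q = V := by
    ext y
    constructor
    · rintro ⟨j, rfl⟩; exact (V.equivFin.symm j).2
    · intro hy; exact ⟨V.equivFin ⟨y, hy⟩, by simp [q]⟩
  let pr : Fin r → (EuclideanSpace ℝ (Fin r) →ₗ[ℝ] ℝ) := fun j =>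
    (EuclideanSpace.proj j : EuclideanSpace ℝ (Fin r) →L[ℝ] ℝ).toLinearMap
  let sm : EuclideanSpace ℝ (Fin r) →ᵃ[ℝ] ℝ := (∑ j, pr j).toAffineMap
  let φ : EuclideanSpace ℝ (Fin r) →ₗ[ℝ] EuclideanSpace ℝ (Fin d) := ∑ j, (pr j).smulRight (q j)
  have hsm : ∀ x, sm x = ∑ j, x j := fun x => by simp [sm, pr]
  have hφ : ∀ x, φ x = ∑ j, x j • q j := fun x => by simp [φ, pr]
  let one : EuclideanSpace ℝ (Fin r) →ᵃ[ℝ] ℝ := AffineMap.const ℝ _ 1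
  refine ⟨r + 2, r, φ.toAffineMap, Fin.append (fun j => (pr j).toAffineMap) ![sm - one, one - sm], ?_⟩
  ext y
  have hset : ∀ x : EuclideanSpace ℝ (Fin r), (∀ i, 0 ≤ (Fin.append (fun j => (pr j).toAffineMap)
      ![sm - one, one - sm] : Fin (r + 2) → (EuclideanSpace ℝ (Fin r) →ᵃ[ℝ] ℝ)) i x) ↔
      (∀ j, 0 ≤ x j) ∧ ∑ j, x j = 1 := by
    intro x
    rw [Fin.forall_fin_add]
    simp only [Fin.append_left, Fin.append_right, Fin.forall_fin_two]
    simp [hsm, one, pr]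
    intro _
    constructor
    · rintro ⟨h1, h2⟩; linarith
    · intro h; constructor <;> linarith
  rw [← hq]
  simp only [Set.mem_image, Set.mem_ofPred_eq]
  simp_rw [hset]
  constructor
  · intro hy
    have hT : Convex ℝ {y | ∃ x : EuclideanSpace ℝ (Fin r),
        ((∀ j, 0 ≤ x j) ∧ ∑ j, x j = 1) ∧ φ.toAffineMap x = y} := by
      rintro _ ⟨x, ⟨h1, h2⟩, rfl⟩ _ ⟨x', ⟨h1', h2'⟩, rfl⟩ α β hα hβ hαβ
      refine ⟨α • x + β • x', ⟨?_, ?_⟩, ?_⟩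
      · intro j
        have := h1 j
        have := h1' j
        simp only [PiLp.add_apply, PiLp.smul_apply, smul_eq_mul]
        positivity
      · simp only [PiLp.add_apply, PiLp.smul_apply, smul_eq_mul]
        rw [Finset.sum_add_distrib, ← Finset.mul_sum, ← Finset.mul_sum, h2, h2']
        linarith
      · simp
    refine convexHull_min ?_ hT hy
    rintro _ ⟨j, rfl⟩
    refine ⟨EuclideanSpace.single j 1, ⟨?_, ?_⟩, ?_⟩
    · intro i
      by_cases h : i = j <;> simp [h]
    · simp
    · rw [LinearMap.coe_toAffineMap, hφ]
      simp
  · rintro ⟨x, ⟨h1, h2⟩, rfl⟩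
    rw [LinearMap.coe_toAffineMap, hφ]
    exact (convex_convexHull ℝ _).sum_mem (fun j _ => h1 j) h2
      (fun j _ => subset_convexHull _ _ ⟨j, rfl⟩)

lemma floor_close {x y T : ℝ} (hT : 0 < T) (hx : 0 ≤ x) (hy : 0 ≤ y)
    (h : ⌊x * T⌋₊ = ⌊y * T⌋₊) : |x - y| ≤ 1 / T := by
  have hx0 : 0 ≤ x * T := by positivity
  have hy0 : 0 ≤ y * T := by positivity
  have h1 := Nat.floor_le hx0
  have h2 := Nat.lt_floor_add_one (x * T)
  have h3 := Nat.floor_le hy0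
  have h4 := Nat.lt_floor_add_one (y * T)
  rw [h] at h1 h2
  rw [le_div_iff₀ hT]
  have : |x - y| * T = |x * T - y * T| := by
    rw [← sub_mul, abs_mul, abs_of_pos hT]
  rw [this, abs_le]
  constructor <;> linarith

lemma card_bound {d k : ℕ} (hd : 1 ≤ d) (F : Finset (Set (EuclideanSpace ℝ (Fin d))))
    (ρ Δ : ℝ) (hρ : 0 < ρ) (hΔ : 0 < Δ)
    (hball : ∀ P ∈ F, P ⊆ Metric.closedBall 0 ρ)
    (hsep : ∀ P ∈ F, ∀ P' ∈ F, P ≠ P' → Δ ≤ Metric.hausdorffDist P P')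
    (henc : ∀ P ∈ F, Nonempty (Enc P k)) :
    F.card ≤ (⌊4 * (2 * ρ / Δ) * ((k : ℝ) + 1) ^ 2 * d⌋₊ + 1) ^ ((k + d) * (k + 1)) := by
  classical
  have hd' : (1 : ℝ) ≤ d := by exact_mod_cast hd
  set T : ℝ := 4 * (2 * ρ / Δ) * ((k : ℝ) + 1) ^ 2 * d with hT
  have hTpos : 0 < T := by positivity
  let e : ∀ P : F, Enc P.1 k := fun P => (henc P.1 P.2).some
  have hco : ∀ (P : F) j i, |(e P).p j i| ≤ ρ := fun P j i => by
    have h1 : ‖(e P).p j‖ ≤ ρ := mem_closedBall_zero_iff.1 (hball P.1 P.2 ((e P).hp j))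
    exact (PiLp.norm_apply_le ((e P).p j) i).trans h1
  let g : F → (Fin k ⊕ Fin d) × Fin (k + 1) → ℝ := fun P ij =>
    Sum.elim (fun i => (e P).s i ij.2) (fun i => ((e P).p ij.2 i + ρ) / (2 * ρ)) ij.1
  have hg0 : ∀ P ij, 0 ≤ g P ij := by
    rintro P ⟨i | i, j⟩
    · exact (e P).hs i j
    · have := abs_le.1 (hco P j i)
      simp only [g, Sum.elim_inr]
      apply div_nonneg <;> linarith
  have hg1 : ∀ P ij, g P ij ≤ 1 := by
    rintro P ⟨i | i, j⟩
    · simp only [g, Sum.elim_inl]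
      rw [← (e P).hsum i]
      exact Finset.single_le_sum (fun j _ => (e P).hs i j) (Finset.mem_univ j)
    · have := abs_le.1 (hco P j i)
      simp only [g, Sum.elim_inr]
      rw [div_le_one (by positivity)]
      linarith
  let code : F → ((Fin k ⊕ Fin d) × Fin (k + 1) → Fin (⌊T⌋₊ + 1)) := fun P ij =>
    ⟨⌊g P ij * T⌋₊, Nat.lt_succ_of_le (Nat.floor_le_floor (by
      have := hg1 P ij
      nlinarith))⟩
  have hclose : ∀ P P' : F, code P = code P' → ∀ x ∈ P.1, ∃ y ∈ P'.1, dist x y ≤ Δ / 2 := by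
    intro P P' h
    have hij : ∀ ij, |g P ij - g P' ij| ≤ 1 / T := fun ij =>
      floor_close hTpos (hg0 _ _) (hg0 _ _) (congrArg Fin.val (congrFun h ij))
    have h1 : ∀ i j, |(e P).s i j - (e P').s i j| ≤ 1 / T := fun i j => hij (Sum.inl i, j)
    have h2 : ∀ j, ‖(e P).p j - (e P').p j‖ ≤ d * (2 * ρ / T) := by
      intro j
      have h3 : ∀ i, |((e P).p j - (e P').p j) i| ≤ 2 * ρ / T := by
        intro i
        have := hij (Sum.inr i, j)
        simp only [g, Sum.elim_inr] at this
        rw [← sub_div, abs_div, abs_of_pos (by positivity : 0 < 2 * ρ),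
          div_le_iff₀ (by positivity)] at this
        rw [PiLp.sub_apply]
        calc _ = |(e P).p j i + ρ - ((e P').p j i + ρ)| := by congr 1; ring
          _ ≤ _ := this
          _ = _ := by ring
      calc ‖(e P).p j - (e P').p j‖
          = ‖∑ i, EuclideanSpace.single i (((e P).p j - (e P').p j) i)‖ := by
            congr 1
            ext l
            simp [Finset.sum_apply, Pi.single_apply]
        _ ≤ ∑ i, ‖EuclideanSpace.single i (((e P).p j - (e P').p j) i)‖ := norm_sum_le _ _
        _ ≤ ∑ i : Fin d, 2 * ρ / T := by
            apply Finset.sum_le_sum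
            intro i _
            rw [EuclideanSpace.norm_single, Real.norm_eq_abs]
            exact h3 i
        _ = d * (2 * ρ / T) := by simp
    intro x hx
    obtain ⟨y, hy, hxy⟩ := enc_close (e P) (e P') (hball P.1 P.2) (by positivity) h1 h2 x hx
    refine ⟨y, hy, hxy.trans ?_⟩
    have e1 : 2 * ρ * (1 / T * ((k : ℝ) + 1) ^ 2) = Δ / 4 / d := by
      rw [hT]; field_simp
    have e2 : ((k : ℝ) + 1) * (d * (2 * ρ / T)) = Δ / 4 / ((k : ℝ) + 1) := by
      rw [hT]; field_simp
    rw [e1, e2]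
    have e3 : Δ / 4 / d ≤ Δ / 4 := div_le_self (by positivity) hd'
    have e4 : Δ / 4 / ((k : ℝ) + 1) ≤ Δ / 4 := div_le_self (by positivity) (by
      have : (0 : ℝ) ≤ k := by positivity
      linarith)
    linarith
  have hinj : Function.Injective code := by
    intro P P' h
    by_contra hne
    have h1 := hsep P.1 P.2 P'.1 P'.2 (fun h => hne (Subtype.ext h))
    have h2 : Metric.hausdorffDist P.1 P'.1 ≤ Δ / 2 :=
      Metric.hausdorffDist_le_of_mem_dist (by positivity) (hclose P P' h) (hclose P' P h.symm)
    linarith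
  have := Fintype.card_le_of_injective code hinj
  simpa using this

lemma final_arith {N d k : ℕ} {r B : ℝ} (hN : 2 ≤ N) (hd : 1 ≤ d) (hk : 1 ≤ k) (hr : 1 ≤ r)
    (hB1 : 1 ≤ B) (hB : B ≤ 4 * r * ((k : ℝ) + 1) ^ 2 * d + 1)
    (hcard : (N : ℝ) ≤ B ^ ((k + d) * (k + 1))) :
    (Real.logb 2 N / (8 * d * (1 + Real.logb 2 r + Real.logb 2 (Real.logb 2 N))))
      ^ ((1 : ℝ) / 2) ≤ k := by
  have hN' : (2 : ℝ) ≤ N := by exact_mod_cast hN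
  have hd' : (1 : ℝ) ≤ d := by exact_mod_cast hd
  have hk' : (1 : ℝ) ≤ k := by exact_mod_cast hk
  set L := Real.logb 2 N with hL
  have hL1 : 1 ≤ L := by
    rw [hL, Real.le_logb_iff_rpow_le (by norm_num) (by linarith)]
    simpa using hN'
  have hlr : 0 ≤ Real.logb 2 r := Real.logb_nonneg (by norm_num) hr
  have hlL : 0 ≤ Real.logb 2 L := Real.logb_nonneg (by norm_num) hL1
  set G := 1 + Real.logb 2 r + Real.logb 2 L with hG
  have hG1 : 1 ≤ G := by linarith
  have hmain : L ≤ 8 * d * G * k ^ 2 := by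
    by_contra hlt
    push Not at hlt
    have h1 : 8 * d * (k : ℝ) ^ 2 ≤ L := by
      have : 8 * d * (k : ℝ) ^ 2 * 1 ≤ 8 * d * (k : ℝ) ^ 2 * G :=
        mul_le_mul_of_nonneg_left hG1 (by positivity)
      linarith
    have h2 : ((k : ℝ) + 1) ^ 2 * d ≤ L / 2 := by
      have : ((k : ℝ) + 1) ^ 2 ≤ 4 * k ^ 2 := by nlinarith
      have := mul_le_mul_of_nonneg_right this (by positivity : (0 : ℝ) ≤ d)
      linarith
    have h3 : B ≤ 4 * r * L := by
      have := mul_le_mul_of_nonneg_left h2 (by positivity : 0 ≤ 4 * r)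
      have : 1 ≤ r * L := one_le_mul_of_one_le_of_one_le hr hL1
      nlinarith
    have h4 : Real.logb 2 B ≤ 2 * G := by
      have e1 : Real.logb 2 B ≤ Real.logb 2 (4 * r * L) :=
        Real.logb_le_logb_of_le (by norm_num) (by linarith) h3
      have e2 : Real.logb 2 (4 * r * L) = 2 + Real.logb 2 r + Real.logb 2 L := by
        rw [Real.logb_mul (by positivity) (by positivity),
          Real.logb_mul (by positivity) (by positivity)]
        have : Real.logb 2 4 = 2 := by
          rw [show (4 : ℝ) = 2 ^ (2 : ℝ) by norm_num]
          exact Real.logb_rpow (by norm_num) (by norm_num)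
        rw [this]
      linarith
    have h5 : L ≤ ((k + d) * (k + 1) : ℝ) * Real.logb 2 B := by
      have := Real.logb_le_logb_of_le (b := 2) (by norm_num) (by linarith) hcard
      rw [Real.logb_pow] at this
      push_cast at this
      exact this
    have h6 : ((k + d) * (k + 1) : ℝ) ≤ 4 * d * k ^ 2 := by
      have e1 : (k + d : ℝ) ≤ 2 * d * k := by nlinarith
      have e2 : (k + 1 : ℝ) ≤ 2 * k := by linarith
      calc ((k + d) * (k + 1) : ℝ) ≤ (2 * d * k) * (2 * k) :=
            mul_le_mul e1 e2 (by positivity) (by positivity)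
        _ = _ := by ring
    have h7 : ((k + d) * (k + 1) : ℝ) * Real.logb 2 B ≤ 4 * d * k ^ 2 * (2 * G) :=
      mul_le_mul h6 h4 (Real.logb_nonneg (by norm_num) hB1) (by positivity)
    nlinarith
  rw [← Real.sqrt_eq_rpow]
  apply Real.sqrt_le_iff.2
  refine ⟨by positivity, ?_⟩
  rw [div_le_iff₀ (by positivity)]
  linarith

theorem statement2 (d : ℕ) (F : Finset (Set (EuclideanSpace ℝ (Fin d))))
    (hcard : 2 ≤ F.card)
    (hpoly : ∀ P ∈ F, IsPolytope P)
    (hdim : ∀ P ∈ F, 1 ≤ Module.finrank ℝ (affineSpan ℝ P).direction)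
    (ρ Δ : ℝ) (hρ : 0 < ρ) (hΔ : 0 < Δ)
    (hball : ∀ P ∈ F, P ⊆ Metric.closedBall 0 ρ)
    (hsep : ∀ P ∈ F, ∀ P' ∈ F, P ≠ P' → Δ ≤ Metric.hausdorffDist P P') :
    ∃ P ∈ F,
      (Real.logb 2 F.card /
          (8 * d * (1 + Real.logb 2 (2 * ρ / Δ) + Real.logb 2 (Real.logb 2 F.card))))
          ^ ((1 : ℝ) / 2)
        ≤ (xc P : ℝ) := by
  classical
  obtain ⟨P₁, hP₁, P₂, hP₂, h12⟩ := Finset.one_lt_card.1 (by omega : 1 < F.card)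
  have hnt : ∀ P ∈ F, ¬ (P = ∅ ∨ ∃ p, P = {p}) := by
    rintro P hP (rfl | ⟨p, rfl⟩)
    · have := hdim _ hP
      simp at this
    · have := hdim _ hP
      rw [direction_affineSpan, vectorSpan_singleton] at this
      simp at this
  have hne : ∀ P ∈ F, P.Nonempty := fun P hP =>
    Set.nonempty_iff_ne_empty.2 fun h => hnt P hP (Or.inl h)
  have hd : 1 ≤ d := by
    have := (hdim P₁ hP₁).trans (Submodule.finrank_le _)
    simpa using this
  have hxc : ∀ P ∈ F, HasLinExt P (xc P) := by
    intro P hP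
    have : xc P = sInf {l | HasLinExt P l} := by
      unfold xc
      rw [if_neg (hnt P hP)]
    rw [this]
    exact Nat.sInf_mem (hpoly P hP).exists_ext
  obtain ⟨P₀, hP₀, hmax⟩ := Finset.exists_max_image F xc ⟨P₁, hP₁⟩
  refine ⟨P₀, hP₀, ?_⟩
  have henc : ∀ P ∈ F, Nonempty (Enc P (xc P₀)) := fun P hP =>
    exists_enc (hpoly P hP) (hne P hP) (hball P hP) ((hxc P hP).mono (hmax P hP))
  have hk : 1 ≤ xc P₀ := by
    by_contra h0
    have h0 : xc P₀ = 0 := by omega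
    have hext := hxc P₀ hP₀
    rw [h0] at hext
    obtain ⟨n, φ, a, ha⟩ := hext
    apply hnt P₀ hP₀
    right
    refine ⟨φ 0, ?_⟩
    have hall : ∀ x, φ x ∈ P₀ := fun x => by rw [ha]; exact ⟨x, fun i => i.elim0, rfl⟩
    have hconst : ∀ x, φ x = φ 0 := fun x => bounded_const φ (ρ := ρ) x 0 fun t =>
      mem_closedBall_zero_iff.1 (hball P₀ hP₀ (hall _))
    apply Set.Subset.antisymm
    · intro y hy
      rw [ha] at hy
      obtain ⟨x, -, rfl⟩ := hy
      exact hconst x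
    · rintro _ rfl
      exact hall 0
  have hr : 1 ≤ 2 * ρ / Δ := by
    rw [le_div_iff₀ hΔ, one_mul]
    refine (hsep P₁ hP₁ P₂ hP₂ h12).trans ?_
    have key : ∀ P ∈ F, ∀ P' ∈ F, ∀ x ∈ P, ∃ y ∈ P', dist x y ≤ 2 * ρ := by
      intro P hP P' hP' x hx
      obtain ⟨y, hy⟩ := hne P' hP'
      refine ⟨y, hy, ?_⟩
      have h1 := mem_closedBall_zero_iff.1 (hball P hP hx)
      have h2 := mem_closedBall_zero_iff.1 (hball P' hP' hy)
      rw [dist_eq_norm]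
      exact (norm_sub_le _ _).trans (by linarith)
    exact Metric.hausdorffDist_le_of_mem_dist (by positivity) (key P₁ hP₁ P₂ hP₂)
      (key P₂ hP₂ P₁ hP₁)
  have hcb := card_bound (k := xc P₀) hd F ρ Δ hρ hΔ hball hsep henc
  refine final_arith (B := (⌊4 * (2 * ρ / Δ) * ((xc P₀ : ℝ) + 1) ^ 2 * d⌋₊ : ℝ) + 1)
    hcard hd hk hr ?_ ?_ ?_
  · have : (0 : ℝ) ≤ (⌊4 * (2 * ρ / Δ) * ((xc P₀ : ℝ) + 1) ^ 2 * d⌋₊ : ℝ) := by positivity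
    linarith
  · have := Nat.floor_le (by positivity : 0 ≤ 4 * (2 * ρ / Δ) * ((xc P₀ : ℝ) + 1) ^ 2 * d)
    linarith
  · exact_mod_cast hcb
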